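/- If K is a weakly Radon–Nikodým compact Hausdorff space, L is a zero-dimensional compact Hausdorff space, and f : K → L is a continuous surjection, then L is weakly Radon–Nikodým. That is, zero-dimensional continuous images of WRN compact spaces are WRN. -/

import Mathlib

open Set Function

/-- A real Banach space `X` *contains an isomorphic copy of `ℓ¹`* if there is a bounded
linear map from `ℓ¹` into `X` which is an isomorphism onto its image, i.e. bounded below. -/
def ContainsL1 (X : Type*) [NormedAddCommGroup X] [NormedSpace ℝ X] : Prop :=
  ∃ T : lp (fun _ : ℕ => ℝ) 1 →L[ℝ] X, ∃ c : ℝ, 0 < c ∧ ∀ v, c * ‖v‖ ≤ ‖T v‖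

/-- A compact (Hausdorff) space is *weakly Radon–Nikodým* if it is homeomorphic to a
weak*-compact subset of the dual of a real Banach space not containing a copy of `ℓ¹`. -/
def IsWRN (K : Type*) [TopologicalSpace K] : Prop :=
  ∃ (X : Type) (_ : NormedAddCommGroup X) (_ : NormedSpace ℝ X) (_ : CompleteSpace X)
    (S : Set (WeakDual ℝ X)), ¬ ContainsL1 X ∧ IsCompact S ∧ Nonempty (K ≃ₜ S)

/-- A sequence of pairs `(A i, B i)` of sets is *independent* if any finitely many choices of one
member from each pair have a common point. -/
def IndepPairs {α : Type*} (A B : ℕ → Set α) : Prop :=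
  ∀ s T : Finset ℕ, ∃ x, ∀ i ∈ s, (i ∈ T → x ∈ A i) ∧ (i ∉ T → x ∈ B i)

/-- The atom of `G` obtained by choosing `A i` for `i ∈ s ∩ T` and `B i` for `i ∈ s \ T`. -/
def atom {α : Type*} (A B : ℕ → Set α) (G : Set α) (s T : Finset ℕ) : Set α :=
  {x ∈ G | ∀ i ∈ s, (i ∈ T → x ∈ A i) ∧ (i ∉ T → x ∈ B i)}

lemma atom_inter {α : Type*} (A B : ℕ → Set α) (G : Set α) (s T : Finset ℕ) :
    atom A B G s (s ∩ T) = atom A B G s T := by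
  ext x
  simp only [atom, mem_ofPred_eq, Finset.mem_inter]
  grind

lemma atom_insert {α : Type*} (A B : ℕ → Set α) (G : Set α) (s T : Finset ℕ) (k : ℕ) :
    atom A B G (insert k s) T = atom A B G s T ∩ A k ∧ k ∈ T ∨
      atom A B G (insert k s) T = atom A B G s T ∩ B k ∧ k ∉ T := by
  by_cases hk : k ∈ T
  · left
    refine ⟨?_, hk⟩
    ext x
    simp only [atom, mem_ofPred_eq, Finset.mem_insert, mem_inter_iff]
    grind
  · right
    refine ⟨?_, hk⟩
    ext x
    simp only [atom, mem_ofPred_eq, Finset.mem_insert, mem_inter_iff]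
    grind

/-- If every finite family of members of `𝒢` can be simultaneously split inside `𝒢` by pairs
of arbitrarily large index, then there is an independent subsequence. -/
lemma exists_indepPairs_subseq {α : Type*} (𝒢 : Set (Set α)) (h𝒢 : ∀ V ∈ 𝒢, V.Nonempty)
    {G : Set α} (hG : G ∈ 𝒢) (A B : ℕ → Set α)
    (h : ∀ F : Set (Set α), F.Finite → F ⊆ 𝒢 → ∀ N, ∃ k, N ≤ k ∧
      ∀ V ∈ F, V ∩ A k ∈ 𝒢 ∧ V ∩ B k ∈ 𝒢) :
    ∃ φ : ℕ → ℕ, StrictMono φ ∧ IndepPairs (A ∘ φ) (B ∘ φ) := by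
  classical
  let Q : Finset ℕ → Prop := fun s => ∀ T, atom A B G s T ∈ 𝒢
  have hQ0 : Q ∅ := fun T => by simpa [atom] using hG
  have step : ∀ s : {s // Q s}, ∃ k, (∀ i ∈ s.1, i < k) ∧ Q (insert k s.1) := by
    rintro ⟨s, hs⟩
    obtain ⟨k, hk, hV⟩ := h ((fun T => atom A B G s T) '' (s.powerset : Set (Finset ℕ)))
      (Set.Finite.image _ (Finset.finite_toSet _)) (by rintro _ ⟨T, -, rfl⟩; exact hs T)
      (s.sup id + 1)
    have hV' : ∀ T, atom A B G s T ∩ A k ∈ 𝒢 ∧ atom A B G s T ∩ B k ∈ 𝒢 := fun T => by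
      rw [← atom_inter]
      exact hV _ ⟨s ∩ T, by simp, rfl⟩
    refine ⟨k, fun i hi => ?_, fun T => ?_⟩
    · have : i ≤ s.sup id := Finset.le_sup (f := id) hi
      omega
    · rcases atom_insert A B G s T k with ⟨h, -⟩ | ⟨h, -⟩ <;> rw [h]
      exacts [(hV' T).1, (hV' T).2]
  choose K hK hKQ using step
  let S : ℕ → {s // Q s} := fun n => Nat.rec ⟨∅, hQ0⟩ (fun _ s => ⟨insert (K s) s.1, hKQ s⟩) n
  have hS : ∀ n, (S (n + 1)).1 = insert (K (S n)) (S n).1 := fun n => rfl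
  let φ : ℕ → ℕ := fun n => K (S n)
  have hmem : ∀ n i, i < n → φ i ∈ (S n).1 := by
    intro n
    induction n with
    | zero => simp
    | succ n ih =>
      intro i hi
      rw [hS, Finset.mem_insert]
      rcases Nat.lt_succ_iff_lt_or_eq.1 hi with h | rfl
      · exact Or.inr (ih i h)
      · exact Or.inl rfl
  have hφ : StrictMono φ := fun i n hin => hK (S n) _ (hmem n i hin)
  refine ⟨φ, hφ, fun s T => ?_⟩
  obtain ⟨x, -, hx⟩ := h𝒢 _ ((S (s.sup id + 1)).2 (T.image φ))
  refine ⟨x, fun i hi => ?_⟩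
  have hi' : i < s.sup id + 1 := Nat.lt_succ_of_le (Finset.le_sup (f := id) hi)
  have := hx _ (hmem _ i hi')
  refine ⟨fun hT => this.1 (Finset.mem_image_of_mem _ hT), fun hT => this.2 fun hT' => hT ?_⟩
  obtain ⟨j, hj, hji⟩ := Finset.mem_image.1 hT'
  rwa [← hφ.injective hji]

/-- Pigeonhole for eventually covered indices. -/
lemma exists_strictMono_of_frequent {ι : Type*} {F : Set ι} (hF : F.Finite) (N : ℕ)
    (P : ι → ℕ → Prop) (h : ∀ k, N ≤ k → ∃ V ∈ F, P V k) :
    ∃ V ∈ F, ∃ φ : ℕ → ℕ, StrictMono φ ∧ ∀ k, P V (φ k) := by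
  have : ∃ᶠ k in Filter.atTop, ∃ V ∈ F, P V k :=
    (Filter.eventually_atTop.2 ⟨N, h⟩).frequently
  rw [Filter.frequently_exists_finite hF] at this
  obtain ⟨V, hV, hP⟩ := this
  exact ⟨V, hV, Filter.extraction_of_frequently_atTop hP⟩

/-- Either a sequence of pairs of open sets has an independent subsequence, or along some
subsequence one of the two sets of each pair misses a fixed nonempty open subset of `G`. -/
lemma indepPairs_or_exists_open {α : Type*} [TopologicalSpace α] {A B : ℕ → Set α}
    (hA : ∀ k, IsOpen (A k)) (hB : ∀ k, IsOpen (B k)) {G : Set α} (hG : IsOpen G)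
    (hGne : G.Nonempty) :
    (∃ φ : ℕ → ℕ, StrictMono φ ∧ IndepPairs (A ∘ φ) (B ∘ φ)) ∨
    ∃ U ⊆ G, IsOpen U ∧ U.Nonempty ∧ ∃ φ : ℕ → ℕ, StrictMono φ ∧
      ∀ k, U ∩ A (φ k) = ∅ ∨ U ∩ B (φ k) = ∅ := by
  by_cases h : ∀ F : Set (Set α), F.Finite → F ⊆ {V | V ⊆ G ∧ IsOpen V ∧ V.Nonempty} → ∀ N,
      ∃ k, N ≤ k ∧ ∀ V ∈ F, V ∩ A k ∈ {V | V ⊆ G ∧ IsOpen V ∧ V.Nonempty} ∧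
        V ∩ B k ∈ {V | V ⊆ G ∧ IsOpen V ∧ V.Nonempty}
  · refine Or.inl (exists_indepPairs_subseq _ (fun V hV => hV.2.2) (G := G) ?_ A B h)
    exact ⟨subset_rfl, hG, hGne⟩
  · right
    push Not at h
    obtain ⟨F, hF, hFG, N, hN⟩ := h
    obtain ⟨U, hU, φ, hφ, hP⟩ := exists_strictMono_of_frequent hF N
      (fun V k => V ∩ A k = ∅ ∨ V ∩ B k = ∅) (fun k hk => by
        obtain ⟨V, hV, hVk⟩ := hN k hk
        refine ⟨V, hV, ?_⟩
        obtain ⟨h1, h2, h3⟩ := hFG hV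
        by_contra! hcon
        exact hVk ⟨inter_subset_left.trans h1, h2.inter (hA k), hcon.1⟩
          ⟨inter_subset_left.trans h1, h2.inter (hB k), hcon.2⟩)
    obtain ⟨h1, h2, h3⟩ := hFG hU
    exact ⟨U, h1, h2, h3, φ, hφ, hP⟩

/-- In a compact space, a sequence of independent clopen sets lives on a closed subset in which
every nonempty relatively open set meets almost all of the sets and of their complements. -/
lemma exists_irreducible {K : Type} [TopologicalSpace K] [CompactSpace K]
    {A : ℕ → Set K} (hA : ∀ k, IsClopen (A k)) (hind : IndepPairs A fun k => (A k)ᶜ) :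
    ∃ E : Set K, E.Nonempty ∧ ∀ U : Set E, IsOpen U → U.Nonempty → ∃ N, ∀ k, N ≤ k →
      (∃ x ∈ U, (x : K) ∈ A k) ∧ ∃ x ∈ U, (x : K) ∉ A k := by
  classical
  let π : K → ℕ → Bool := fun x k => (A k).boolIndicator x
  have hπ : Continuous π := continuous_pi fun k =>
    (continuous_boolIndicator_iff_isClopen _).2 (hA k)
  have hsurj : Function.Surjective π := by
    intro τ
    have hne : (⋂ k, {x | π x k = τ k}).Nonempty := by
      refine CompactSpace.iInter_nonempty (fun k => ?_) fun s => ?_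
      · exact isClosed_eq ((continuous_apply k).comp hπ) continuous_const
      · obtain ⟨x, hx⟩ := hind s (s.filter fun k => τ k = true)
        refine ⟨x, ?_⟩
        simp only [mem_iInter, mem_ofPred_eq]
        intro k hk
        have := hx k hk
        by_cases hτ : τ k = true
        · simpa [π, hτ, ← mem_iff_boolIndicator] using this.1 (by simp [hk, hτ])
        · simpa [π, Bool.eq_false_of_not_eq_true hτ, ← notMem_iff_boolIndicator] using this.2 (by simp [hτ])
    obtain ⟨x, hx⟩ := hne
    exact ⟨x, funext fun k => mem_iInter.1 hx k⟩
  obtain ⟨E, hE, hEimg, hmin⟩ := exists_compact_surjective_zorn_subset hπ hsurj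
  refine ⟨E, ?_, fun U hU hUne => ?_⟩
  · by_contra hne
    rw [not_nonempty_iff_eq_empty] at hne
    rw [hne, image_empty] at hEimg
    exact empty_ne_univ hEimg
  · have hlt := hmin Uᶜ (by simpa using hUne.ne_empty) hU.isClosed_compl
    have hcl : IsClosed (E.domRestrict π '' Uᶜ) :=
      (hU.isClosed_compl.isCompact.image (hπ.comp continuous_subtype_val)).isClosed
    obtain ⟨τ, hτ⟩ := (ne_univ_iff_exists_notMem _).1 hlt
    obtain ⟨I, u, hu, hsub⟩ := isOpen_pi_iff.1 hcl.isOpen_compl τ hτ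
    refine ⟨I.sup id + 1, fun k hk => ?_⟩
    have hkI : k ∉ I := fun h => by
      have : k ≤ I.sup id := Finset.le_sup (f := id) h
      omega
    have key : ∀ b : Bool, ∃ x ∈ U, π (x : K) k = b := by
      intro b
      have hmem : Function.update τ k b ∈ (E.domRestrict π '' Uᶜ)ᶜ := by
        apply hsub
        intro i hi
        rw [Function.update_of_ne (by rintro rfl; exact hkI hi)]
        exact (hu i hi).2
      obtain ⟨x, hxE, hx⟩ := (hEimg ▸ mem_univ (Function.update τ k b) : _ ∈ π '' E)
      refine ⟨⟨x, hxE⟩, ?_, by simp [hx]⟩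
      by_contra hxU
      exact hmem ⟨⟨x, hxE⟩, hxU, hx⟩
    obtain ⟨x, hx, hxk⟩ := key true
    obtain ⟨y, hy, hyk⟩ := key false
    exact ⟨⟨x, hx, (mem_iff_boolIndicator _ _).2 hxk⟩, ⟨y, hy, (notMem_iff_boolIndicator _ _).2 hyk⟩⟩

/-- The sequence `y` satisfies a lower `ℓ¹`-estimate with constant `c` with respect to `q`. -/
def L1Lower {V : Type*} [AddCommGroup V] [Module ℝ V] (q : V → ℝ) (y : ℕ → V) (c : ℝ) : Prop :=
  ∀ (s : Finset ℕ) (a : ℕ → ℝ), c * ∑ k ∈ s, |a k| ≤ q (∑ k ∈ s, a k • y k)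

lemma lp_one_hasSum_abs (v : lp (fun _ : ℕ => ℝ) 1) : HasSum (fun k => |v k|) ‖v‖ := by
  simpa using lp.hasSum_norm (p := 1) (by simp) v

lemma containsL1_of_l1Lower {X : Type*} [NormedAddCommGroup X] [NormedSpace ℝ X]
    [CompleteSpace X] {y : ℕ → X} {R c : ℝ} (hR : ∀ k, ‖y k‖ ≤ R) (hc : 0 < c)
    (hy : L1Lower norm y c) : ContainsL1 X := by
  have hbd : ∀ (v : lp (fun _ : ℕ => ℝ) 1) k, ‖v k • y k‖ ≤ |v k| * R := fun v k => by
    rw [norm_smul, Real.norm_eq_abs]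
    exact mul_le_mul_of_nonneg_left (hR k) (abs_nonneg _)
  have hsumR : ∀ v : lp (fun _ : ℕ => ℝ) 1, HasSum (fun k => |v k| * R) (‖v‖ * R) :=
    fun v => (lp_one_hasSum_abs v).mul_right R
  have hsum : ∀ v : lp (fun _ : ℕ => ℝ) 1, Summable fun k => v k • y k := fun v =>
    Summable.of_norm_bounded (hsumR v).summable (hbd v)
  let T₀ : lp (fun _ : ℕ => ℝ) 1 →ₗ[ℝ] X :=
    { toFun := fun v => ∑' k, v k • y k
      map_add' := fun v w => by
        rw [← (hsum v).tsum_add (hsum w)]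
        simp [add_smul]
      map_smul' := fun r v => by
        simp only [RingHom.id_apply]
        rw [← (hsum v).tsum_const_smul r]
        simp [mul_smul] }
  have hT₀ : ∀ v, ‖T₀ v‖ ≤ R * ‖v‖ := fun v => by
    rw [mul_comm]
    exact tsum_of_norm_bounded (hsumR v) (hbd v)
  refine ⟨T₀.mkContinuous R hT₀, c, hc, fun v => ?_⟩
  have h1 := ((lp_one_hasSum_abs v).mul_left c)
  have h2 := (hsum v).hasSum.norm
  refine le_of_tendsto_of_tendsto h1 h2 (Filter.Eventually.of_forall fun s => ?_)
  simpa [Finset.mul_sum] using hy s v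

lemma exists_l1Lower_of_containsL1 {X : Type*} [NormedAddCommGroup X] [NormedSpace ℝ X]
    (h : ContainsL1 X) :
    ∃ (y : ℕ → X) (R c : ℝ), (∀ k, ‖y k‖ ≤ R) ∧ 0 < c ∧ L1Lower norm y c := by
  obtain ⟨T, c, hc, hT⟩ := h
  refine ⟨fun k => T (lp.single 1 k 1), ‖T‖, c, fun k => ?_, hc, fun s a => ?_⟩
  · refine (T.le_opNorm _).trans_eq ?_
    rw [lp.norm_single (by simp)]
    simp
  · have h1 := hT (∑ k ∈ s, lp.single 1 k (a k))
    have h2 := lp.norm_sum_single (p := 1) (E := fun _ : ℕ => ℝ) (by simp) a s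
    simp only [ENNReal.toReal_one, Real.rpow_one, Real.norm_eq_abs] at h2
    rw [h2, map_sum] at h1
    convert h1 using 3 with k hk
    rw [← map_smul, ← lp.single_smul]
    simp

/-- Independent level sets of a bounded sequence of evaluations produce a copy of `ℓ¹`. -/
lemma containsL1_of_indepPairs {X : Type*} [NormedAddCommGroup X] [NormedSpace ℝ X]
    [CompleteSpace X] {S : Set (WeakDual ℝ X)} {M R p q : ℝ} (hS : ∀ s ∈ S, ∀ x, |s x| ≤ M * ‖x‖)
    {x : ℕ → X} (hx : ∀ k, ‖x k‖ ≤ R) (hpq : p < q)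
    (hind : IndepPairs (fun k => {s : S | s.1 (x k) < p}) fun k => {s : S | q < s.1 (x k)}) :
    ContainsL1 X := by
  classical
  have hM : 0 < |M| + 1 := by positivity
  refine containsL1_of_l1Lower hx (c := (q - p) / (2 * (|M| + 1)))
    (div_pos (sub_pos.2 hpq) (by positivity)) fun s a => ?_
  obtain ⟨σ, hσ⟩ := hind s (s.filter fun k => a k < 0)
  obtain ⟨τ, hτ⟩ := hind s (s.filter fun k => 0 ≤ a k)
  have h1 : (q - p) * ∑ k ∈ s, |a k| ≤ (σ.1 - τ.1) (∑ k ∈ s, a k • x k) := by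
    rw [map_sum, Finset.mul_sum]
    refine Finset.sum_le_sum fun k hk => ?_
    rw [map_smul, smul_eq_mul]
    change _ ≤ a k * (σ.1 (x k) - τ.1 (x k))
    have hσk := hσ k hk
    have hτk := hτ k hk
    simp only [Finset.mem_filter, hk, true_and, mem_ofPred_eq, not_lt, not_le] at hσk hτk
    rcases lt_or_ge (a k) 0 with h | h
    · rw [abs_of_neg h]
      nlinarith [hσk.1 h, hτk.2 h]
    · rw [abs_of_nonneg h]
      nlinarith [hσk.2 h, hτk.1 h]
  set z := ∑ k ∈ s, a k • x k with hz
  have h2 : (σ.1 - τ.1) z ≤ 2 * (|M| + 1) * ‖z‖ := by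
    change σ.1 z - τ.1 z ≤ _
    have h3 := (abs_le.1 (hS _ σ.2 z)).2
    have h4 := (abs_le.1 (hS _ τ.2 z)).1
    nlinarith [le_abs_self M, norm_nonneg z]
  rw [div_mul_eq_mul_div, div_le_iff₀ (by positivity)]
  linarith

lemma exists_bound_of_isCompact {X : Type*} [NormedAddCommGroup X] [NormedSpace ℝ X]
    [CompleteSpace X] {S : Set (WeakDual ℝ X)} (hS : IsCompact S) :
    ∃ M, ∀ s ∈ S, ∀ x, |s x| ≤ M * ‖x‖ := by
  have h : Bornology.IsBounded S := by
    rw [WeakDual.isBounded_iff_isVonNBounded]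
    exact hS.isVonNBounded ℝ
  rw [← WeakDual.isBounded_toWeakDual_preimage_iff_isBounded] at h
  obtain ⟨M, hM⟩ := h.exists_norm_le
  refine ⟨M, fun s hs x => ?_⟩
  have h1 := hM (WeakDual.toStrongDual s) (by simpa using hs)
  exact (ContinuousLinearMap.le_opNorm (WeakDual.toStrongDual s) x).trans
    (mul_le_mul_of_nonneg_right h1 (norm_nonneg _))

/-- `C ⊆ S` and its complement are `1`-separated by `n` evaluations at points of norm at most `n`. -/
def SepBy {X : Type*} [NormedAddCommGroup X] [NormedSpace ℝ X] {S : Set (WeakDual ℝ X)} (n : ℕ)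
    (C : Set S) : Prop :=
  ∃ x : ℕ → X, (∀ i, ‖x i‖ ≤ n) ∧ ∀ a ∈ C, ∀ b ∉ C, ∃ i < n, 1 ≤ |a.1 (x i) - b.1 (x i)|

lemma exists_sepBy {X : Type*} [NormedAddCommGroup X] [NormedSpace ℝ X]
    {S : Set (WeakDual ℝ X)} [CompactSpace S] {C : Set S} (hC : IsClopen C) :
    ∃ n, SepBy n C := by
  classical
  have hcomp : IsCompact (C ×ˢ Cᶜ) := hC.1.isCompact.prod hC.compl.1.isCompact
  have hev : ∀ x : X, Continuous fun s : S => s.1 x := fun x =>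
    (WeakDual.eval_continuous x).comp continuous_subtype_val
  obtain ⟨t, ht⟩ := hcomp.elim_finite_subcover (fun x : X => {z : S × S | 1 < |z.1.1 x - z.2.1 x|})
    (fun x => isOpen_lt continuous_const
      (((hev x).comp continuous_fst).sub ((hev x).comp continuous_snd)).abs) (by
      rintro ⟨a, b⟩ ⟨ha, hb⟩
      have hab : a.1 ≠ b.1 := fun h => hb (Subtype.ext h ▸ ha)
      obtain ⟨x, hx⟩ := DFunLike.ne_iff.1 hab
      have hpos : 0 < |a.1 x - b.1 x| := abs_pos.2 (sub_ne_zero.2 hx)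
      refine mem_iUnion.2 ⟨(2 / |a.1 x - b.1 x|) • x, ?_⟩
      simp only [mem_ofPred_eq, map_smul, smul_eq_mul]
      rw [← mul_sub, abs_mul, abs_of_pos (by positivity), div_mul_cancel₀ _ hpos.ne']
      norm_num)
  obtain ⟨N, hN⟩ := exists_nat_ge (∑ x ∈ t, ‖x‖)
  have htN : ∀ x ∈ t, ‖x‖ ≤ N := fun x hx =>
    (Finset.single_le_sum (f := fun x => ‖x‖) (fun _ _ => norm_nonneg _) hx).trans hN
  refine ⟨N + t.card, fun i => t.toList.getD i 0, fun i => ?_, fun a ha b hb => ?_⟩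
  · beta_reduce
    rcases lt_or_ge i t.toList.length with h | h
    · rw [List.getD_eq_getElem _ _ h]
      push_cast
      have := htN _ (Finset.mem_toList.1 (List.getElem_mem h))
      linarith [(Nat.cast_nonneg t.card : (0 : ℝ) ≤ t.card)]
    · rw [List.getD_eq_default _ _ h, norm_zero]
      positivity
  · obtain ⟨x, hx, hxab⟩ := mem_iUnion₂.1 (ht (show (a, b) ∈ C ×ˢ Cᶜ from ⟨ha, hb⟩))
    obtain ⟨i, hi, rfl⟩ := List.getElem_of_mem (Finset.mem_toList.2 hx)
    refine ⟨i, ?_, ?_⟩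
    · rw [Finset.length_toList] at hi
      omega
    · simp only
      rw [List.getD_eq_getElem _ _ hi]
      exact le_of_lt hxab

/-- If `X` does not contain `ℓ¹`, bounded families of evaluations have small oscillation on
some nonempty open set along a subsequence. -/
lemma exists_open_levels {X : Type*} [NormedAddCommGroup X] [NormedSpace ℝ X] [CompleteSpace X]
    {S : Set (WeakDual ℝ X)} {M R : ℝ} (hX : ¬ ContainsL1 X)
    (hS : ∀ s ∈ S, ∀ x, |s x| ≤ M * ‖x‖) {E : Set S} (hE : E.Nonempty) {x : ℕ → ℕ → X}
    (hx : ∀ k i, ‖x k i‖ ≤ R) {δ : ℝ} (hδ : 0 < δ) (T : Finset (ℕ × ℤ)) :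
    ∃ U : Set E, IsOpen U ∧ U.Nonempty ∧ ∃ φ : ℕ → ℕ, StrictMono φ ∧ ∀ k, ∀ t ∈ T,
      (∀ s ∈ U, δ * t.2 ≤ s.1.1 (x (φ k) t.1)) ∨
      (∀ s ∈ U, s.1.1 (x (φ k) t.1) ≤ δ * (t.2 + 1)) := by
  classical
  induction T using Finset.induction_on with
  | empty =>
    have : Nonempty E := hE.to_subtype
    exact ⟨univ, isOpen_univ, univ_nonempty, id, strictMono_id, by simp⟩
  | insert t T _ ih =>
    obtain ⟨U, hU, hUne, φ, hφ, h⟩ := ih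
    have hev : ∀ x : X, Continuous fun s : E => s.1.1 x := fun x =>
      (WeakDual.eval_continuous x).comp (continuous_subtype_val.comp continuous_subtype_val)
    rcases indepPairs_or_exists_open
      (A := fun k => {s : E | s.1.1 (x (φ k) t.1) < δ * t.2})
      (B := fun k => {s : E | δ * (t.2 + 1) < s.1.1 (x (φ k) t.1)})
      (fun k => isOpen_lt (hev _) continuous_const) (fun k => isOpen_lt continuous_const (hev _))
      hU hUne with ⟨ψ, hψ, hind⟩ | ⟨V, hVU, hV, hVne, ψ, hψ, hVk⟩
    · refine (hX (containsL1_of_indepPairs hS (x := fun k => x (φ (ψ k)) t.1) (fun k => hx _ _)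
        (p := δ * t.2) (q := δ * (t.2 + 1)) (by nlinarith) ?_)).elim
      intro s T'
      obtain ⟨z, hz⟩ := hind s T'
      exact ⟨z.1, hz⟩
    · refine ⟨V, hV, hVne, φ ∘ ψ, hφ.comp hψ, fun k t' ht' => ?_⟩
      rcases Finset.mem_insert.1 ht' with rfl | ht'
      · refine (hVk k).imp (fun h s hs => ?_) fun h s hs => ?_
        · by_contra! hlt
          exact (h ▸ ⟨hs, hlt⟩ : s ∈ (∅ : Set E))
        · by_contra! hlt
          exact (h ▸ ⟨hs, hlt⟩ : s ∈ (∅ : Set E))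
      · exact (h (ψ k) t' ht').imp (fun h s hs => h s (hVU hs)) fun h s hs => h s (hVU hs)

/-- In the dual of a space not containing `ℓ¹`, no sequence of clopen sets which are uniformly
separated from their complements is independent. -/
lemma not_indepPairs_of_sepBy {X : Type} [NormedAddCommGroup X] [NormedSpace ℝ X]
    [CompleteSpace X] {S : Set (WeakDual ℝ X)} (hX : ¬ ContainsL1 X) [CompactSpace S] {n : ℕ}
    {C : ℕ → Set S} (hC : ∀ k, IsClopen (C k)) (hsep : ∀ k, SepBy n (C k)) :
    ¬ IndepPairs C fun k => (C k)ᶜ := by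
  intro hind
  obtain ⟨M, hM⟩ := exists_bound_of_isCompact (isCompact_iff_compactSpace.2 ‹CompactSpace S›)
  obtain ⟨E, hE, hirr⟩ := exists_irreducible hC hind
  choose x hxn hx using hsep
  obtain ⟨J, hJ⟩ := exists_nat_ge (4 * (|M| * n) + 2)
  obtain ⟨U, hU, hUne, φ, hφ, hlev⟩ := exists_open_levels hX hM hE hxn
    (δ := 1 / 4) (by norm_num) (Finset.range n ×ˢ Finset.Icc (-J : ℤ) J)
  obtain ⟨N, hN⟩ := hirr U hU hUne
  obtain ⟨⟨a, haU, haC⟩, b, hbU, hbC⟩ := hN (φ N) hφ.le_apply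
  obtain ⟨i, hi, hab⟩ := hx (φ N) a haC b hbC
  have hbound : ∀ s : E, |s.1.1 (x (φ N) i)| ≤ |M| * n := fun s =>
    (hM _ s.1.2 _).trans (mul_le_mul (le_abs_self M) (hxn _ _) (norm_nonneg _) (abs_nonneg _))
  have key : ∀ s ∈ U, ∀ s' ∈ U, s'.1.1 (x (φ N) i) ≤ s.1.1 (x (φ N) i) + 1 / 2 := by
    intro s hs s' hs'
    set j : ℤ := ⌊4 * s.1.1 (x (φ N) i)⌋ + 1 with hj
    have hfl := Int.floor_le (4 * s.1.1 (x (φ N) i))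
    have hfl' := Int.lt_floor_add_one (4 * s.1.1 (x (φ N) i))
    have hb := abs_le.1 (hbound s)
    have hjc : (j : ℝ) = ⌊4 * s.1.1 (x (φ N) i)⌋ + 1 := by rw [hj]; push_cast; ring
    have hjJ : j ∈ Finset.Icc (-J : ℤ) J := by
      rw [Finset.mem_Icc]
      constructor
      · have : (-J : ℝ) ≤ j := by linarith
        exact_mod_cast this
      · have : (j : ℝ) ≤ J := by linarith
        exact_mod_cast this
    rcases hlev N (i, j) (Finset.mem_product.2 ⟨Finset.mem_range.2 hi, hjJ⟩) with h | h
    · have := h s hs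
      simp only at this
      linarith
    · have := h s' hs'
      simp only at this
      linarith
  have h1 := key a haU b hbU
  have h2 := key b hbU a haU
  have : |a.1.1 (x (φ N) i) - b.1.1 (x (φ N) i)| ≤ 1 / 2 := abs_le.2 ⟨by linarith, by linarith⟩
  linarith

open MeasureTheory Filter Topology in
lemma exists_weak_limit {H : Type*} [NormedAddCommGroup H] [InnerProductSpace ℝ H]
    [CompleteSpace H] {x : ℕ → H} {R : ℝ} (hx : ∀ k, ‖x k‖ ≤ R) (U : Ultrafilter ℕ) :
    ∃ h : H, ∀ u, Tendsto (fun k => inner ℝ (x k) u) U (𝓝 (inner ℝ h u)) := by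
  let ψ : ℕ → WeakDual ℝ H := fun k =>
    StrongDual.toWeakDual (InnerProductSpace.toDual ℝ H (x k))
  have hK := WeakDual.isCompact_closedBall (𝕜 := ℝ) (E := H) 0 R
  obtain ⟨φ, -, hφ⟩ := hK.ultrafilter_le_nhds' (U.map ψ) (by
    rw [Ultrafilter.mem_map]
    refine Filter.univ_mem' fun k => ?_
    change WeakDual.toStrongDual (ψ k) ∈ Metric.closedBall _ _
    rw [mem_closedBall_zero_iff]
    change ‖InnerProductSpace.toDual ℝ H (x k)‖ ≤ R
    rw [LinearIsometryEquiv.norm_map]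
    exact hx k)
  refine ⟨(InnerProductSpace.toDual ℝ H).symm (WeakDual.toStrongDual φ), fun u => ?_⟩
  rw [InnerProductSpace.toDual_symm_apply]
  have h1 : Tendsto ψ U (𝓝 φ) := hφ
  have h2 := ((WeakDual.eval_continuous (𝕜 := ℝ) u).tendsto φ).comp h1
  exact h2

open MeasureTheory Filter Topology in
lemma exists_setIntegral_limit {Ω : Type*} [MeasurableSpace Ω] (μ : Measure Ω)
    [IsFiniteMeasure μ] {C : ℕ → Set Ω} (hC : ∀ k, MeasurableSet (C k)) (U : Ultrafilter ℕ) :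
    ∃ h : Ω → ℝ, Measurable h ∧ Integrable h μ ∧ ∀ V, MeasurableSet V →
      Tendsto (fun k => μ.real (V ∩ C k)) U (𝓝 (∫ x in V, h x ∂μ)) := by
  obtain ⟨h, hh⟩ := exists_weak_limit (H := Lp ℝ 2 μ)
    (x := fun k => indicatorConstLp 2 (hC k) (measure_ne_top μ _) (1 : ℝ))
    (R := μ.real univ ^ (1 / (2 : ENNReal).toReal)) (fun k => by
      rw [norm_indicatorConstLp (by simp) (by simp)]
      simp only [norm_one, one_mul]
      gcongr
      · simp
      · exact subset_univ _) U
  refine ⟨h, (Lp.stronglyMeasurable h).measurable, (Lp.memLp h).integrable one_le_two,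
    fun V hV => ?_⟩
  have := hh (indicatorConstLp 2 hV (measure_ne_top μ _) (1 : ℝ))
  rw [real_inner_comm, L2.inner_indicatorConstLp_one] at this
  refine this.congr fun k => ?_
  rw [real_inner_comm, L2.real_inner_indicatorConstLp_one_indicatorConstLp_one]

open MeasureTheory Filter Topology in
/-- Measurable sets which are uniformly separated in measure have an independent subsequence. -/
lemma exists_indepPairs_of_measure_separated {Ω : Type*} [MeasurableSpace Ω] (μ : Measure Ω)
    [IsFiniteMeasure μ] {C : ℕ → Set Ω} (hC : ∀ k, MeasurableSet (C k)) {η : ℝ} (hη : 0 < η)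
    (hsep : ∀ k l, k ≠ l → η ≤ μ.real (C k \ C l) + μ.real (C l \ C k)) :
    ∃ φ : ℕ → ℕ, StrictMono φ ∧ IndepPairs (C ∘ φ) ((fun k => (C k)ᶜ) ∘ φ) := by
  obtain ⟨h, hmeas, hInt, hlim⟩ := exists_setIntegral_limit μ hC (hyperfilter ℕ)
  have hlim' : ∀ V, MeasurableSet V →
      Tendsto (fun k => μ.real (V ∩ (C k)ᶜ)) (hyperfilter ℕ) (𝓝 (∫ x in V, (1 - h x) ∂μ)) := by
    intro V hV
    have h1 : ∫ x in V, (1 - h x) ∂μ = μ.real V - ∫ x in V, h x ∂μ := by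
      rw [integral_sub (integrable_const _) hInt.integrableOn]
      simp
    rw [h1]
    refine ((hlim V hV).const_sub (μ.real V)).congr fun k => ?_
    have := measureReal_inter_add_sdiff (μ := μ) (s := V) (hC k)
    rw [← sdiff_eq]
    linarith
  have h0 : 0 ≤ᵐ[μ] h := ae_nonneg_of_forall_setIntegral_nonneg hInt fun V hV _ =>
    ge_of_tendsto' (hlim V hV) fun k => measureReal_nonneg
  have h1 : 0 ≤ᵐ[μ] fun x => 1 - h x :=
    ae_nonneg_of_forall_setIntegral_nonneg ((integrable_const _).sub hInt) fun V hV _ =>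
      ge_of_tendsto' (hlim' V hV) fun k => measureReal_nonneg
  set D : Set Ω := {x | h x ≠ 0} with hD
  have hDm : MeasurableSet D := (measurableSet_eq_fun hmeas measurable_const).compl
  set G : Set Ω := {x | h x ≠ 0 ∧ 1 - h x ≠ 0} with hG
  have hGm : MeasurableSet G := hDm.inter
    (measurableSet_eq_fun (measurable_const.sub hmeas) measurable_const).compl
  have hGpos : 0 < μ G := by
    rw [pos_iff_ne_zero]
    intro hG0
    have hae : ∀ᵐ x ∂μ, h x ≠ 0 → 1 - h x = 0 := by
      filter_upwards [compl_mem_ae_iff.2 hG0] with x hx hx0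
      by_contra hx1
      exact hx ⟨hx0, hx1⟩
    have e1 : ∫ x in D, (1 - h x) ∂μ = 0 := by
      rw [setIntegral_congr_ae (g := fun _ => 0) hDm]
      · simp
      · filter_upwards [hae] with x hx hxD using hx hxD
    have e2 : ∫ x in Dᶜ, h x ∂μ = 0 := by
      rw [setIntegral_congr_fun (g := fun _ => 0) hDm.compl]
      · simp
      · intro x hx
        simpa [hD] using hx
    have t1 := hlim' D hDm
    have t2 := hlim Dᶜ hDm.compl
    rw [e1] at t1
    rw [e2] at t2
    have e : ∀ᶠ k in (hyperfilter ℕ : Filter ℕ),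
        μ.real (D ∩ (C k)ᶜ) < η / 4 ∧ μ.real (Dᶜ ∩ C k) < η / 4 :=
      (t1.eventually_lt_const (by positivity)).and (t2.eventually_lt_const (by positivity))
    obtain ⟨k, hk⟩ := e.exists
    have hcof : ∀ᶠ l in (hyperfilter ℕ : Filter ℕ), l ≠ k :=
      hyperfilter_le_cofinite ((finite_singleton k).compl_mem_cofinite)
    obtain ⟨l, hl, hlk⟩ := (e.and hcof).exists
    have hle : ∀ k l, μ.real (C k \ C l) ≤ μ.real (Dᶜ ∩ C k) + μ.real (D ∩ (C l)ᶜ) := by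
      intro k l
      refine (measureReal_mono ?_).trans (measureReal_union_le _ _)
      intro x hx
      by_cases hxD : x ∈ D
      · exact Or.inr ⟨hxD, hx.2⟩
      · exact Or.inl ⟨hxD, hx.1⟩
    have := hsep k l hlk.symm
    linarith [hle k l, hle l k]
  refine exists_indepPairs_subseq {V | MeasurableSet V ∧ V ⊆ G ∧ 0 < μ V}
    (fun V hV => nonempty_of_measure_ne_zero hV.2.2.ne') (G := G) ⟨hGm, subset_rfl, hGpos⟩ _ _
    fun F hF hFG N => ?_
  have key : ∀ V ∈ F, ∀ᶠ k in (hyperfilter ℕ : Filter ℕ),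
      V ∩ C k ∈ {V | MeasurableSet V ∧ V ⊆ G ∧ 0 < μ V} ∧
      V ∩ (C k)ᶜ ∈ {V | MeasurableSet V ∧ V ⊆ G ∧ 0 < μ V} := by
    intro V hV
    obtain ⟨hVm, hVG, hVpos⟩ := hFG hV
    have p1 : 0 < ∫ x in V, h x ∂μ := by
      rw [setIntegral_pos_iff_support_of_nonneg_ae (ae_restrict_of_ae h0) hInt.integrableOn]
      rwa [inter_eq_right.2 (show V ⊆ support h from fun x hx => (hVG hx).1)]
    have p2 : 0 < ∫ x in V, (1 - h x) ∂μ := by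
      rw [setIntegral_pos_iff_support_of_nonneg_ae (ae_restrict_of_ae h1)
        ((integrable_const _).sub hInt).integrableOn]
      rwa [inter_eq_right.2 (show V ⊆ support fun x => 1 - h x from fun x hx => (hVG hx).2)]
    filter_upwards [(hlim V hVm).eventually_const_lt p1, (hlim' V hVm).eventually_const_lt p2]
      with k hk1 hk2
    exact ⟨⟨hVm.inter (hC k), inter_subset_left.trans hVG, (ENNReal.toReal_pos_iff.1 hk1).1⟩,
      ⟨hVm.inter (hC k).compl, inter_subset_left.trans hVG, (ENNReal.toReal_pos_iff.1 hk2).1⟩⟩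
  have hall := (hF.eventually_all (l := (hyperfilter ℕ : Filter ℕ))).2 key
  have hN : ∀ᶠ k in (hyperfilter ℕ : Filter ℕ), N ≤ k := by
    refine hyperfilter_le_cofinite ?_
    rw [Nat.cofinite_eq_atTop]
    exact eventually_ge_atTop N
  obtain ⟨k, hk1, hk2⟩ := (hN.and hall).exists
  exact ⟨k, hk1, hk2⟩

lemma exists_signs_sum_mul_nonpos {ι : Type*} (t : Finset ι) (w : ι → ℝ) (P : ι → ℕ × ℕ)
    (hP : ∀ i ∈ t, (P i).1 ≠ (P i).2) :
    ∃ ε : ℕ → ℝ, (∀ k, ε k = 1 ∨ ε k = -1) ∧ ∑ i ∈ t, w i * (ε (P i).1 * ε (P i).2) ≤ 0 := by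
  classical
  let ε : Finset ℕ → ℕ → ℝ := fun T k => if k ∈ T then 1 else -1
  let s : Finset ℕ := t.image fun i => (P i).1
  have hzero : ∀ i ∈ t, ∑ T ∈ s.powerset, ε T (P i).1 * ε T (P i).2 = 0 := by
    intro i hi
    refine Finset.sum_involution (fun T _ => symmDiff T {(P i).1}) ?_ ?_ ?_ ?_
    · intro T _
      have := hP i hi
      simp only [ε, Finset.mem_symmDiff, Finset.mem_singleton]
      by_cases h1 : (P i).1 ∈ T <;> by_cases h2 : (P i).2 ∈ T <;> simp [h1, h2, this.symm]
    · intro T _ _ h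
      have : (P i).1 ∈ symmDiff T {(P i).1} ↔ (P i).1 ∈ T := by rw [h]
      simp [Finset.mem_symmDiff] at this
    · intro T hT
      rw [Finset.mem_powerset] at hT ⊢
      intro k hk
      rw [Finset.mem_symmDiff, Finset.mem_singleton] at hk
      rcases hk with hk | hk
      · exact hT hk.1
      · rw [hk.1]
        exact Finset.mem_image_of_mem _ hi
    · intro T _
      exact symmDiff_symmDiff_cancel_right _ _
  obtain ⟨T, -, hT⟩ := Finset.exists_le_of_sum_le (s := s.powerset)
    (f := fun T => ∑ i ∈ t, w i * (ε T (P i).1 * ε T (P i).2)) (g := fun _ => 0)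
    (Finset.powerset_nonempty _) (by
      rw [Finset.sum_comm]
      simp_rw [← Finset.mul_sum]
      rw [Finset.sum_congr rfl fun i hi => by rw [hzero i hi]]
      simp)
  refine ⟨ε T, fun k => ?_, hT⟩
  by_cases h : k ∈ T <;> simp [ε, h]

open ContinuousMap in
lemma exists_le_sum_abs_sub {L : Type*} [TopologicalSpace L] [CompactSpace L] {g : ℕ → C(L, ℝ)}
    {δ : ℝ} (hδ : 0 < δ) (hg : L1Lower norm g δ) {ι : Type*} (t : Finset ι) {w : ι → ℝ}
    (hw : ∀ i ∈ t, 0 ≤ w i) (hw1 : ∑ i ∈ t, w i = 1) {P : ι → ℕ × ℕ}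
    (hP : ∀ i ∈ t, (P i).1 ≠ (P i).2) :
    ∃ x, δ ≤ ∑ i ∈ t, w i * |g (P i).1 x - g (P i).2 x| := by
  classical
  by_contra! hlt
  obtain ⟨ε, hε, hsum⟩ := exists_signs_sum_mul_nonpos t w P hP
  let σ : ι → ℝ := fun i => (ε (P i).1 - ε (P i).2) / 2
  let s : Finset ℕ := (t.image fun i => (P i).1) ∪ t.image fun i => (P i).2
  let a : ℕ → ℝ := fun k =>
    ∑ i ∈ t, w i * σ i * ((if k = (P i).1 then 1 else 0) - if k = (P i).2 then 1 else 0)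
  have hs1 : ∀ i ∈ t, (P i).1 ∈ s := fun i hi =>
    Finset.mem_union_left _ (Finset.mem_image_of_mem _ hi)
  have hs2 : ∀ i ∈ t, (P i).2 ∈ s := fun i hi =>
    Finset.mem_union_right _ (Finset.mem_image_of_mem (fun i => (P i).2) hi)
  have hε1 : ∀ k, ε k * ε k = 1 := fun k => by rcases hε k with h | h <;> simp [h]
  have hcomb : ∀ v : ℕ → ℝ, ∑ k ∈ s, a k * v k =
      ∑ i ∈ t, w i * σ i * (v (P i).1 - v (P i).2) := by
    intro v
    simp only [a, Finset.sum_mul]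
    rw [Finset.sum_comm]
    refine Finset.sum_congr rfl fun i hi => ?_
    simp_rw [mul_assoc, ← Finset.mul_sum, sub_mul, ite_mul, one_mul, zero_mul]
    rw [Finset.sum_sub_distrib, Finset.sum_ite_eq' s, Finset.sum_ite_eq' s, if_pos (hs1 i hi),
      if_pos (hs2 i hi)]
  have ha : 1 ≤ ∑ k ∈ s, |a k| := by
    have h1 : ∑ k ∈ s, a k * ε k = 1 - ∑ i ∈ t, w i * (ε (P i).1 * ε (P i).2) := by
      rw [hcomb, ← hw1, ← Finset.sum_sub_distrib]
      refine Finset.sum_congr rfl fun i _ => ?_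
      simp only [σ]
      linear_combination (w i / 2) * (hε1 (P i).1 + hε1 (P i).2)
    calc (1 : ℝ) ≤ ∑ k ∈ s, a k * ε k := by rw [h1]; linarith
      _ ≤ ∑ k ∈ s, |a k| := Finset.sum_le_sum fun k _ => by
        refine (le_abs_self _).trans_eq ?_
        rw [abs_mul]
        rcases hε k with h | h <;> simp [h]
  have hnorm : ‖∑ k ∈ s, a k • g k‖ < δ := by
    rw [ContinuousMap.norm_lt_iff _ hδ]
    intro x
    have hx : (∑ k ∈ s, a k • g k) x = ∑ k ∈ s, a k * g k x := by
      simp [ContinuousMap.sum_apply]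
    rw [hx, hcomb fun k => g k x]
    refine lt_of_le_of_lt ((Finset.abs_sum_le_sum_abs _ _).trans ?_) (hlt x)
    refine Finset.sum_le_sum fun i hi => ?_
    rw [abs_mul, abs_mul, abs_of_nonneg (hw i hi)]
    have : |σ i| ≤ 1 := by
      simp only [σ]
      rcases hε (P i).1 with h | h <;> rcases hε (P i).2 with h' | h' <;> rw [h, h'] <;> norm_num
    gcongr
    exact mul_le_of_le_one_right (hw i hi) this
  have := hg s a
  nlinarith

open ContinuousMap in
lemma exists_positive_functional {L : Type*} [TopologicalSpace L] [CompactSpace L]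
    {g : ℕ → C(L, ℝ)} {δ : ℝ} (hδ : 0 < δ) (hg : L1Lower norm g δ) :
    ∃ (Λ : C(L, ℝ) →L[ℝ] ℝ) (u : ℝ), (∀ f, 0 ≤ f → 0 ≤ Λ f) ∧ 0 < u ∧
      ∀ k l, k ≠ l → u ≤ Λ |g k - g l| := by
  let A : Set C(L, ℝ) := {f | ∀ x, f x < δ}
  let B : Set C(L, ℝ) := {f | ∃ p : ℕ × ℕ, p.1 ≠ p.2 ∧ f = |g p.1 - g p.2|}
  have hAopen : IsOpen A := by
    have := ContinuousMap.isOpen_setOfPred_mapsTo (X := L) (Y := ℝ) isCompact_univ (isOpen_Iio (a := δ))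
    convert this using 1
    ext f
    simp [A, MapsTo]
  have hAconv : Convex ℝ A := by
    intro f hf f' hf' a b ha hb hab x
    have := convex_Iio (𝕜 := ℝ) δ (hf x) (hf' x) ha hb hab
    simpa using this
  have hdisj : Disjoint A (convexHull ℝ B) := by
    rw [Set.disjoint_left]
    intro f hfA hfB
    rw [convexHull_eq] at hfB
    obtain ⟨ι, t, w, z, hw, hw1, hz, rfl⟩ := hfB
    have hz' : ∀ i, ∃ p : ℕ × ℕ, i ∈ t → p.1 ≠ p.2 ∧ z i = |g p.1 - g p.2| := fun i => by
      by_cases hi : i ∈ t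
      · obtain ⟨p, hp⟩ := hz i hi
        exact ⟨p, fun _ => hp⟩
      · exact ⟨0, fun h => absurd h hi⟩
    choose P hP using hz'
    obtain ⟨x, hx⟩ := exists_le_sum_abs_sub hδ hg t hw hw1 fun i hi => (hP i hi).1
    refine absurd (hfA x) (not_lt.2 (hx.trans_eq ?_))
    rw [Finset.centerMass_eq_of_sum_1 _ _ hw1]
    simp only [ContinuousMap.sum_apply, ContinuousMap.smul_apply, smul_eq_mul]
    refine Finset.sum_congr rfl fun i hi => ?_
    rw [(hP i hi).2]
    simp
  obtain ⟨Λ, u, hA, hB⟩ := geometric_hahn_banach_open hAconv hAopen (convex_convexHull ℝ B) hdisj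
  refine ⟨Λ, u, fun f hf => ?_, ?_, fun k l hkl =>
    hB _ (subset_convexHull ℝ B ⟨(k, l), hkl, rfl⟩)⟩
  · by_contra! hneg
    have := hA (-((-(u / Λ f)) ⊔ 0) • f) (fun x => by
      have : 0 ≤ f x := hf x
      have h2 : 0 ≤ ((-(u / Λ f)) ⊔ 0) := le_sup_right
      simp only [ContinuousMap.smul_apply, smul_eq_mul]
      nlinarith [mul_nonneg h2 this])
    rw [map_smul, smul_eq_mul] at this
    have h3 : -(u / Λ f) ≤ ((-(u / Λ f)) ⊔ 0) := le_sup_left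
    have h4 : u / Λ f * Λ f = u := div_mul_cancel₀ _ hneg.ne
    nlinarith
  · have := hA 0 (fun x => by simpa using hδ)
    simpa using this

/-- The indicator function of a clopen set as a continuous function. -/
noncomputable def clopenIndicator {L : Type*} [TopologicalSpace L] {C : Set L} (hC : IsClopen C) :
    C(L, ℝ) :=
  ⟨C.indicator 1, hC.continuous_indicator continuous_one⟩

lemma clopenIndicator_apply {L : Type*} [TopologicalSpace L] {C : Set L} (hC : IsClopen C)
    (x : L) : clopenIndicator hC x = C.indicator 1 x := rfl

open MeasureTheory CompactlySupportedContinuousMap in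
/-- Existence part of the Riesz–Markov–Kakutani theorem on a compact space. -/
lemma exists_measure_integral_eq {L : Type*} [TopologicalSpace L] [CompactSpace L] [T2Space L]
    [MeasurableSpace L] [BorelSpace L] (Λ : C(L, ℝ) →L[ℝ] ℝ) (hΛ : ∀ f, 0 ≤ f → 0 ≤ Λ f) :
    ∃ μ : Measure L, IsFiniteMeasure μ ∧ ∀ f : C(L, ℝ), ∫ x, f x ∂μ = Λ f := by
  let Λ' : CompactlySupportedContinuousMap L ℝ →ₚ[ℝ] ℝ := PositiveLinearMap.mk₀
    { toFun := fun f => Λ (continuousMapEquiv.symm f)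
      map_add' := fun f g => Λ.map_add (continuousMapEquiv.symm f) (continuousMapEquiv.symm g)
      map_smul' := fun c f => Λ.map_smul c (continuousMapEquiv.symm f) }
    fun f hf => hΛ _ hf
  have hreg : (RealRMK.rieszMeasure Λ').Regular := inferInstance
  refine ⟨RealRMK.rieszMeasure Λ', inferInstance, fun f => ?_⟩
  exact RealRMK.integral_rieszMeasure Λ' (continuousMapEquiv f)

open MeasureTheory in
lemma exists_indepPairs_of_functional_separated {L : Type*} [TopologicalSpace L] [CompactSpace L]
    [T2Space L] {Λ : C(L, ℝ) →L[ℝ] ℝ} (hΛ : ∀ f, 0 ≤ f → 0 ≤ Λ f) {C : ℕ → Set L}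
    (hC : ∀ k, IsClopen (C k)) {η : ℝ} (hη : 0 < η)
    (hsep : ∀ k l, k ≠ l → η ≤ Λ |clopenIndicator (hC k) - clopenIndicator (hC l)|) :
    ∃ φ : ℕ → ℕ, StrictMono φ ∧ IndepPairs (C ∘ φ) ((fun k => (C k)ᶜ) ∘ φ) := by
  borelize L
  obtain ⟨μ, hμ, hInt⟩ := exists_measure_integral_eq Λ hΛ
  have hm : ∀ k, MeasurableSet (C k) := fun k => (hC k).isOpen.measurableSet
  refine exists_indepPairs_of_measure_separated μ hm hη fun k l hkl => (hsep k l hkl).trans_eq ?_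
  rw [← hInt]
  have : ∀ x, |clopenIndicator (hC k) - clopenIndicator (hC l)| x =
      (C k \ C l).indicator 1 x + (C l \ C k).indicator 1 x := by
    intro x
    rw [ContinuousMap.abs_apply, ContinuousMap.sub_apply, clopenIndicator_apply,
      clopenIndicator_apply]
    by_cases h1 : x ∈ C k <;> by_cases h2 : x ∈ C l <;> simp [h1, h2]
  simp_rw [this]
  have h1 : Integrable (1 : L → ℝ) μ := integrable_const 1
  rw [integral_add (h1.indicator ((hm k).diff (hm l)))
    (h1.indicator ((hm l).diff (hm k))),
    integral_indicator_one ((hm k).diff (hm l)), integral_indicator_one ((hm l).diff (hm k))]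

lemma map_abs_sum_smul_le {L : Type*} [TopologicalSpace L] {Λ : C(L, ℝ) →L[ℝ] ℝ}
    (hΛ : ∀ f, 0 ≤ f → 0 ≤ Λ f) {ι : Type*} (s : Finset ι) (c : ι → ℝ)
    (f : ι → C(L, ℝ)) : Λ |∑ i ∈ s, c i • f i| ≤ ∑ i ∈ s, |c i| * Λ |f i| := by
  have h := hΛ (∑ i ∈ s, |c i| • |f i| - |∑ i ∈ s, c i • f i|) <| ContinuousMap.le_def.2 fun x => by
    simp only [ContinuousMap.sub_apply, ContinuousMap.sum_apply, ContinuousMap.smul_apply,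
      ContinuousMap.abs_apply, ContinuousMap.zero_apply, smul_eq_mul, ← abs_mul, sub_nonneg]
    exact Finset.abs_sum_le_sum_abs _ _
  simpa using h

lemma map_abs_add_le {L : Type*} [TopologicalSpace L] {Λ : C(L, ℝ) →L[ℝ] ℝ}
    (hΛ : ∀ f, 0 ≤ f → 0 ≤ Λ f) (f g : C(L, ℝ)) : Λ |f + g| ≤ Λ |f| + Λ |g| := by
  have h := hΛ (|f| + |g| - |f + g|) <| ContinuousMap.le_def.2 fun x => by
    simpa using abs_add_le (f x) (g x)
  simp only [map_sub, map_add] at h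
  linarith

lemma map_abs_le_norm {L : Type*} [TopologicalSpace L] [CompactSpace L] (Λ : C(L, ℝ) →L[ℝ] ℝ)
    (f : C(L, ℝ)) : Λ |f| ≤ ‖Λ‖ * ‖f‖ := by
  refine (le_abs_self _).trans ((Λ.le_opNorm |f|).trans ?_)
  gcongr
  refine (ContinuousMap.norm_le _ (norm_nonneg f)).2 fun x => ?_
  simpa using f.norm_coe_le_norm x

open Filter Topology in
lemma exists_map_abs_sub_lt {L : Type*} [TopologicalSpace L] [CompactSpace L] {Λ : C(L, ℝ) →L[ℝ] ℝ}
    (hΛ : ∀ f, 0 ≤ f → 0 ≤ Λ f) {Γ : Type*} {u : Γ → C(L, ℝ)}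
    (hnet : ∀ η : ℝ, 0 < η → ∃ T : Finset Γ, ∀ γ, ∃ τ ∈ T, Λ |u γ - u τ| ≤ η)
    {y : ℕ → Γ →₀ ℝ} {R : ℝ} (hy : ∀ k, (y k).sum (fun _ a => |a|) ≤ R) {δ : ℝ} (hδ : 0 < δ) :
    ∃ k l, k ≠ l ∧
      Λ |Finsupp.linearCombination ℝ u (y k) - Finsupp.linearCombination ℝ u (y l)| < δ := by
  classical
  have hR : 0 ≤ R := (Finset.sum_nonneg fun _ _ => abs_nonneg _).trans (hy 0)
  obtain ⟨T, hT⟩ := hnet (δ / (4 * (R + 1))) (by positivity)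
  choose τ hτT hτ using hT
  let τ' : Γ → T := fun γ => ⟨τ γ, hτT γ⟩
  let z : ℕ → T → ℝ := fun k t => ∑ γ ∈ (y k).support with τ' γ = t, y k γ
  let F : (T → ℝ) → C(L, ℝ) := fun w => ∑ t, w t • u t
  have hF : Continuous F := by fun_prop
  have hz : ∀ k, z k ∈ Metric.closedBall (0 : T → ℝ) R := by
    intro k
    rw [mem_closedBall_zero_iff, pi_norm_le_iff_of_nonneg hR]
    intro t
    refine (Finset.abs_sum_le_sum_abs _ _).trans (le_trans ?_ (hy k))
    exact Finset.sum_le_sum_of_subset_of_nonneg (Finset.filter_subset _ _)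
      fun _ _ _ => abs_nonneg _
  have happrox : ∀ k, Λ |Finsupp.linearCombination ℝ u (y k) - F (z k)| ≤ δ / 4 := by
    intro k
    have e : Finsupp.linearCombination ℝ u (y k) - F (z k) =
        ∑ γ ∈ (y k).support, y k γ • (u γ - u (τ γ)) := by
      simp only [F, z, Finset.sum_smul, smul_sub, Finset.sum_sub_distrib,
        Finsupp.linearCombination_apply, Finsupp.sum]
      rw [← Finset.sum_fiberwise (y k).support τ' fun γ => y k γ • u (τ γ)]
      congr 1
      refine Finset.sum_congr rfl fun t _ => Finset.sum_congr rfl fun γ hγ => ?_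
      rw [← (Finset.mem_filter.1 hγ).2]
    rw [e]
    refine (map_abs_sum_smul_le hΛ _ _ _).trans ?_
    calc _ ≤ ∑ γ ∈ (y k).support, |y k γ| * (δ / (4 * (R + 1))) :=
          Finset.sum_le_sum fun γ _ => mul_le_mul_of_nonneg_left (hτ γ) (abs_nonneg _)
      _ ≤ R * (δ / (4 * (R + 1))) := by
          rw [← Finset.sum_mul]
          exact mul_le_mul_of_nonneg_right (hy k) (by positivity)
      _ ≤ δ / 4 := by
          rw [mul_div_assoc', div_le_div_iff₀ (by positivity) (by positivity)]
          nlinarith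
  obtain ⟨w, -, φ, hφ, hlim⟩ := tendsto_subseq_of_bounded Metric.isBounded_closedBall hz
  have hC := ((hF.tendsto w).comp hlim).cauchySeq
  obtain ⟨N, hN⟩ := Metric.cauchySeq_iff'.1 hC (δ / (4 * (‖Λ‖ + 1))) (by positivity)
  have h1 := hN (N + 1) (by lia)
  refine ⟨φ (N + 1), φ N, (hφ (Nat.lt_succ_self N)).ne', ?_⟩
  rw [dist_eq_norm] at h1
  have h2 : Λ |F (z (φ (N + 1))) - F (z (φ N))| ≤ δ / 4 := by
    refine (map_abs_le_norm _ _).trans ?_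
    calc _ ≤ (‖Λ‖ + 1) * (δ / (4 * (‖Λ‖ + 1))) := by
          gcongr
          · linarith
          · exact h1.le
      _ = δ / 4 := by field_simp
  have e : Finsupp.linearCombination ℝ u (y (φ (N + 1))) - Finsupp.linearCombination ℝ u (y (φ N))
      = (Finsupp.linearCombination ℝ u (y (φ (N + 1))) - F (z (φ (N + 1)))) +
        (F (z (φ (N + 1))) - F (z (φ N))) +
        (F (z (φ N)) - Finsupp.linearCombination ℝ u (y (φ N))) := by abel
  have h3 := happrox (φ N)
  rw [abs_sub_comm] at h3
  rw [e]
  have := map_abs_add_le hΛ ((Finsupp.linearCombination ℝ u (y (φ (N + 1))) - F (z (φ (N + 1)))) +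
        (F (z (φ (N + 1))) - F (z (φ N)))) (F (z (φ N)) - Finsupp.linearCombination ℝ u (y (φ N)))
  have := map_abs_add_le hΛ (Finsupp.linearCombination ℝ u (y (φ (N + 1))) - F (z (φ (N + 1))))
        (F (z (φ (N + 1))) - F (z (φ N)))
  linarith [happrox (φ (N + 1))]

/-- Clopen sets `C` with `P n C` for some `n`, tagged with a witnessing index `n`. -/
abbrev TaggedClopen {L : Type*} [TopologicalSpace L] (P : ℕ → Set L → Prop) : Type _ :=
  Σ n : ℕ, {C : Set L // IsClopen C ∧ P n C}

/-- The indicator function of a tagged clopen set, scaled down according to the tag. -/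
noncomputable def scaledIndicator {L : Type*} [TopologicalSpace L] (P : ℕ → Set L → Prop)
    (γ : TaggedClopen P) : C(L, ℝ) :=
  (1 / (γ.1 + 1 : ℝ)) • clopenIndicator γ.2.2.1

lemma norm_scaledIndicator_le {L : Type*} [TopologicalSpace L] [CompactSpace L] 
    (P : ℕ → Set L → Prop) (γ : TaggedClopen P) :
    ‖scaledIndicator P γ‖ ≤ 1 / (γ.1 + 1 : ℝ) := by
  have h : ‖clopenIndicator γ.2.2.1‖ ≤ 1 := by
    rw [ContinuousMap.norm_le _ zero_le_one]
    intro x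
    rw [clopenIndicator_apply]
    by_cases hx : x ∈ γ.2.1 <;> simp [hx]
  rw [scaledIndicator, norm_smul, Real.norm_of_nonneg (by positivity)]
  exact mul_le_of_le_one_right (by positivity) h

lemma exists_finset_map_abs_sub_le {L : Type*} [TopologicalSpace L] [CompactSpace L] [T2Space L]
    {Λ : C(L, ℝ) →L[ℝ] ℝ} (hΛ : ∀ f, 0 ≤ f → 0 ≤ Λ f) {P : ℕ → Set L → Prop}
    (hP : ∀ n (C : ℕ → Set L), (∀ k, IsClopen (C k)) → (∀ k, P n (C k)) →
      ¬ IndepPairs C fun k => (C k)ᶜ) {η : ℝ} (hη : 0 < η) :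
    ∃ T : Finset (TaggedClopen P), ∀ γ, ∃ τ ∈ T,
      Λ |scaledIndicator P γ - scaledIndicator P τ| ≤ η := by
  by_contra! hno
  have : Std.Symm fun a b : TaggedClopen P =>
      η < Λ |scaledIndicator P b - scaledIndicator P a| :=
    ⟨fun a b h => by rwa [abs_sub_comm]⟩
  obtain ⟨γ, -, hγ⟩ := exists_seq_of_forall_finset_exists'
    (fun _ : TaggedClopen P => True)
    (fun a b => η < Λ |scaledIndicator P b - scaledIndicator P a|)
    (fun T _ => by
      obtain ⟨g, hg⟩ := hno T
      exact ⟨g, trivial, hg⟩)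
  obtain ⟨N, hN⟩ := exists_nat_gt (2 * ‖Λ‖ / η)
  obtain ⟨n, hn⟩ := Finite.exists_infinite_fiber
    fun k => (⟨min (γ k).1 N, by lia⟩ : Fin (N + 1))
  have hinf := Set.infinite_coe_iff.1 hn
  let φ := hinf.natEmbedding
  have hφ : ∀ k, min (γ (φ k)).1 N = n := fun k => congrArg Fin.val (φ k).2
  have hφinj : ∀ {k l}, k ≠ l → (φ k : ℕ) ≠ φ l := fun h =>
    Subtype.val_injective.ne (φ.injective.ne h)
  by_cases hnN : n.1 = N
  · have hbd : ∀ k, ‖scaledIndicator P (γ (φ k))‖ ≤ 1 / (N + 1 : ℝ) := fun k => by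
      refine (norm_scaledIndicator_le P _).trans ?_
      have : N ≤ (γ (φ k)).1 := by
        have := hφ k
        lia
      gcongr
    have h1 := hγ (hφinj (zero_ne_one (α := ℕ)))
    have h2 : Λ |scaledIndicator P (γ (φ 1)) - scaledIndicator P (γ (φ 0))| ≤
        ‖Λ‖ * (1 / (N + 1 : ℝ) + 1 / (N + 1 : ℝ)) :=
      (map_abs_le_norm _ _).trans (mul_le_mul_of_nonneg_left
        ((norm_sub_le _ _).trans (add_le_add (hbd 1) (hbd 0))) Λ.opNorm_nonneg)
    have h3 : ‖Λ‖ * (1 / (N + 1 : ℝ) + 1 / (N + 1 : ℝ)) = 2 * ‖Λ‖ / (N + 1) := by ring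
    rw [h3] at h2
    have h4 : 2 * ‖Λ‖ / (N + 1) < η := by
      rw [div_lt_iff₀ hη] at hN
      rw [div_lt_iff₀ (by positivity)]
      nlinarith
    exact absurd h1 (not_lt.2 (h2.trans h4.le))
  · have hfst : ∀ k, (γ (φ k)).1 = n := fun k => by
      have := hφ k
      have := n.2
      lia
    let C : ℕ → Set L := fun k => (γ (φ k)).2.1
    have hC : ∀ k, IsClopen (C k) := fun k => (γ (φ k)).2.2.1
    have hPC : ∀ k, P n (C k) := fun k => hfst k ▸ (γ (φ k)).2.2.2
    have hscaled : ∀ k, scaledIndicator P (γ (φ k)) =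
        (1 / ((n : ℕ) + 1 : ℝ)) • clopenIndicator (hC k) := fun k => by
      change (1 / (((γ (φ k)).1 : ℕ) + 1 : ℝ)) • clopenIndicator (hC k) = _
      rw [hfst]
    obtain ⟨ψ, -, hψ⟩ := exists_indepPairs_of_functional_separated hΛ hC hη fun k l hkl => by
      have h1 := hγ (hφinj hkl.symm)
      simp only [onFun] at h1
      rw [hscaled, hscaled, ← smul_sub] at h1
      refine h1.le.trans ?_
      have hc : |(1 / ((n : ℕ) + 1 : ℝ))| ≤ 1 := by
        rw [abs_of_nonneg (by positivity), div_le_one (by positivity)]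
        simp
      have h2 := map_abs_sum_smul_le hΛ {()} (fun _ => (1 / ((n : ℕ) + 1 : ℝ)))
        fun _ => clopenIndicator (hC k) - clopenIndicator (hC l)
      simp only [Finset.sum_singleton] at h2
      exact h2.trans (mul_le_of_le_one_left (hΛ _ (abs_nonneg _)) hc)
    exact hP n (C ∘ ψ) (fun k => hC _) (fun k => hPC _) hψ

lemma not_l1Lower_linearCombination {L : Type*} [TopologicalSpace L] [CompactSpace L] [T2Space L]
    {P : ℕ → Set L → Prop}
    (hP : ∀ n (C : ℕ → Set L), (∀ k, IsClopen (C k)) → (∀ k, P n (C k)) →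
      ¬ IndepPairs C fun k => (C k)ᶜ) {y : ℕ → TaggedClopen P →₀ ℝ} {R : ℝ}
    (hy : ∀ k, (y k).sum (fun _ a => |a|) ≤ R) {c : ℝ} (hc : 0 < c) :
    ¬ L1Lower (fun v => ‖Finsupp.linearCombination ℝ (scaledIndicator P) v‖) y c := by
  intro h
  have hg : L1Lower norm (fun k => Finsupp.linearCombination ℝ (scaledIndicator P) (y k)) c := by
    intro s a
    simpa using h s a
  obtain ⟨Λ, u, hΛ, hu, hsep⟩ := exists_positive_functional hc hg
  obtain ⟨k, l, hkl, hlt⟩ := exists_map_abs_sub_lt hΛ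
    (fun η hη => exists_finset_map_abs_sub_le hΛ hP hη) hy hu
  exact absurd (hsep k l hkl) (not_le.2 hlt)

section Interpolation

variable {V : Type*} [AddCommGroup V] [Module ℝ V]

lemma exists_range_sum_of_not_l1Lower {q : Seminorm ℝ V} {y : ℕ → V} {η : ℝ}
    (h : ¬ L1Lower q y η) :
    ∃ (K : ℕ) (b : ℕ → ℝ), ∑ k ∈ Finset.range K, |b k| = 1 ∧
      q (∑ k ∈ Finset.range K, b k • y k) < η := by
  simp only [L1Lower] at h
  push Not at h
  obtain ⟨s, a, hsa⟩ := h
  have hS0 : 0 ≤ ∑ k ∈ s, |a k| := Finset.sum_nonneg fun _ _ => abs_nonneg _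
  have hS : 0 < ∑ k ∈ s, |a k| := by
    refine hS0.lt_of_ne fun h0 => ?_
    rw [← h0, mul_zero] at hsa
    exact absurd hsa (not_lt.2 (apply_nonneg q _))
  set S := ∑ k ∈ s, |a k|
  have hsub : s ⊆ Finset.range (s.sup id + 1) := fun k hk =>
    Finset.mem_range.2 (Nat.lt_succ_of_le (Finset.le_sup (f := id) hk))
  refine ⟨s.sup id + 1, fun k => if k ∈ s then S⁻¹ * a k else 0, ?_, ?_⟩
  · rw [← Finset.sum_subset hsub fun k _ hk => by simp [hk]]
    rw [Finset.sum_congr rfl fun k hk => by beta_reduce; rw [if_pos hk, abs_mul, abs_of_pos (inv_pos.2 hS)],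
      ← Finset.mul_sum]
    exact inv_mul_cancel₀ hS.ne'
  · rw [← Finset.sum_subset hsub fun k _ hk => by simp [hk]]
    rw [Finset.sum_congr rfl fun k hk => by beta_reduce; rw [if_pos hk, mul_smul], ← Finset.smul_sum,
      map_smul_eq_mul, Real.norm_of_nonneg (inv_pos.2 hS).le, inv_mul_lt_iff₀ hS]
    linarith

lemma seminorm_sum_smul_le (q : Seminorm ℝ V) {y : ℕ → V} {M : ℝ} (hy : ∀ k, q (y k) ≤ M)
    (s : Finset ℕ) (a : ℕ → ℝ) : q (∑ k ∈ s, a k • y k) ≤ (∑ k ∈ s, |a k|) * M := by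
  refine (Finset.le_sum_of_subadditive q (map_zero q).le (map_add_le_add q) _ _).trans ?_
  rw [Finset.sum_mul]
  refine Finset.sum_le_sum fun k _ => ?_
  rw [map_smul_eq_mul, Real.norm_eq_abs]
  exact mul_le_mul_of_nonneg_left (hy k) (abs_nonneg _)

/-- `N` is the supremum of the gauges `p m` interpolating between `2⁻ᵐ q₁` and `2ᵐ q₂`. -/
structure IsInterpolation (q₁ q₂ N : Seminorm ℝ V) (p : ℕ → Seminorm ℝ V) : Prop where
  le : ∀ m x, p m x ≤ N x
  le_of_forall_le : ∀ x C, (∀ m, p m x ≤ C) → N x ≤ C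
  le_left : ∀ m x, p m x ≤ (2 ^ m)⁻¹ * q₁ x
  le_right : ∀ m x, p m x ≤ 2 ^ m * q₂ x
  exists_lt : ∀ m x C, p m x < C → ∃ u, (2 ^ m)⁻¹ * q₁ u + 2 ^ m * q₂ (x - u) < C

lemma exists_isInterpolation {q₁ q₂ : Seminorm ℝ V} (hq : q₂ ≤ q₁) :
    ∃ N p, IsInterpolation q₁ q₂ N p ∧ q₂ ≤ N ∧ N ≤ q₁ := by
  let c : ℕ → NNReal := fun m => 2 ^ m
  let p : ℕ → Seminorm ℝ V := fun m => ((c m)⁻¹ • q₁) ⊓ (c m • q₂)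
  have happ : ∀ m x, p m x = ⨅ u, ((2 ^ m)⁻¹ * q₁ u + 2 ^ m * q₂ (x - u)) := fun m x => by
    simp only [p, c, Seminorm.inf_apply, smul_apply, NNReal.smul_def, smul_eq_mul]
    norm_num
  have hleft : ∀ m x, p m x ≤ (2 ^ m)⁻¹ * q₁ x := fun m x => by
    have : p m ≤ (c m)⁻¹ • q₁ := inf_le_left
    simpa [c, smul_apply, NNReal.smul_def] using this x
  have hright : ∀ m x, p m x ≤ 2 ^ m * q₂ x := fun m x => by
    have : p m ≤ c m • q₂ := inf_le_right
    simpa [c, smul_apply, NNReal.smul_def] using this x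
  have hle : ∀ m, p m ≤ q₁ := fun m x => by
    refine (hleft m x).trans (mul_le_of_le_one_left (apply_nonneg _ _) ?_)
    exact inv_le_one_of_one_le₀ (one_le_pow₀ one_le_two)
  have hbdd : BddAbove (range p) := ⟨q₁, by rintro _ ⟨m, rfl⟩; exact hle m⟩
  have hpN : ∀ m, p m ≤ ⨆ m, p m := fun m => le_ciSup hbdd m
  refine ⟨⨆ m, p m, p, ⟨fun m x => hpN m x, fun x C h => ?_, hleft, hright, fun m x C h => ?_⟩,
    ?_, ciSup_le hle⟩
  · rw [Seminorm.iSup_apply hbdd]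
    exact ciSup_le h
  · rw [happ] at h
    exact exists_lt_of_ciInf_lt h
  · refine le_trans ?_ (hpN 0)
    refine le_inf ?_ ?_
    · simpa [c] using hq
    · simp [c]

lemma exists_range_sum_lt {q₁ q₂ N : Seminorm ℝ V} {p : ℕ → Seminorm ℝ V}
    (h : IsInterpolation q₁ q₂ N p)
    (H : ∀ (R : ℝ) (y : ℕ → V), (∀ k, q₁ (y k) ≤ R) → ∀ c, 0 < c → ¬ L1Lower q₂ y c)
    {y : ℕ → V} {M : ℝ} (hy : ∀ k, N (y k) ≤ M) {η : ℝ} (hη : 0 < η) :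
    ∃ (K : ℕ) (b : ℕ → ℝ), ∑ k ∈ Finset.range K, |b k| = 1 ∧
      q₂ (∑ k ∈ Finset.range K, b k • y k) < η := by
  refine exists_range_sum_of_not_l1Lower fun hlow => ?_
  have hM : 0 ≤ M := (apply_nonneg N _).trans (hy 0)
  obtain ⟨m, hm⟩ := pow_unbounded_of_one_lt ((M + 1) / (η / 2)) one_lt_two
  rw [div_lt_iff₀ (by positivity)] at hm
  choose v hv using fun k =>
    h.exists_lt m (y k) (M + 1) (((h.le m (y k)).trans (hy k)).trans_lt (lt_add_one M))
  have h2 : (0 : ℝ) < 2 ^ m := by positivity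
  have hv1 : ∀ k, q₁ (v k) ≤ 2 ^ m * (M + 1) := fun k => by
    rw [← inv_mul_le_iff₀ h2]
    nlinarith [hv k, mul_nonneg h2.le (apply_nonneg q₂ (y k - v k))]
  have hv2 : ∀ k, q₂ (y k - v k) ≤ η / 2 := fun k => by
    have := mul_nonneg (inv_nonneg.2 h2.le) (apply_nonneg q₁ (v k))
    have h3 : 2 ^ m * q₂ (y k - v k) ≤ 2 ^ m * (η / 2) := by linarith [hv k]
    exact le_of_mul_le_mul_left h3 h2
  refine H _ v hv1 (η / 2) (by positivity) fun s a => ?_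
  have h3 := hlow s a
  have h4 := seminorm_sum_smul_le q₂ hv2 s a
  have h5 := map_add_le_add q₂ (∑ k ∈ s, a k • v k) (∑ k ∈ s, a k • (y k - v k))
  have e : ∑ k ∈ s, a k • v k + ∑ k ∈ s, a k • (y k - v k) = ∑ k ∈ s, a k • y k := by
    rw [← Finset.sum_add_distrib]
    exact Finset.sum_congr rfl fun k _ => by rw [← smul_add, add_sub_cancel]
  rw [e] at h5
  linarith

lemma exists_range_sum_le {q₁ q₂ N : Seminorm ℝ V} {p : ℕ → Seminorm ℝ V}
    (h : IsInterpolation q₁ q₂ N p)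
    (H : ∀ (R : ℝ) (y : ℕ → V), (∀ k, q₁ (y k) ≤ R) → ∀ c, 0 < c → ¬ L1Lower q₂ y c)
    {y : ℕ → V} {M : ℝ} (hy : ∀ k, N (y k) ≤ M) {η : ℝ} (hη : 0 < η) (n : ℕ) :
    ∃ (K : ℕ) (a : ℕ → ℝ), ∑ k ∈ Finset.range K, |a k| = n ∧
      N (∑ k ∈ Finset.range K, a k • y k) ≤ M + n * η := by
  have hM : 0 ≤ M := (apply_nonneg N _).trans (hy 0)
  induction n with
  | zero => exact ⟨0, 0, by simp, by simpa using hM⟩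
  | succ n ih =>
    obtain ⟨K, a, ha, hN⟩ := ih
    set W := ∑ k ∈ Finset.range K, a k • y k with hW
    obtain ⟨m, hm⟩ := pow_unbounded_of_one_lt (q₁ W / η) one_lt_two
    rw [div_lt_iff₀ hη] at hm
    have hm2 : (0 : ℝ) < 2 ^ m := by positivity
    obtain ⟨J, b, hb, hq⟩ := exists_range_sum_lt h H (fun k => hy (K + k)) (η := (2 ^ m)⁻¹ * η)
      (by positivity)
    set w := ∑ k ∈ Finset.range J, b k • y (K + k) with hw
    have hNw : N w ≤ M := by
      simpa [hb] using seminorm_sum_smul_le N (fun k => hy (K + k)) (Finset.range J) b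
    refine ⟨K + J, fun k => if k < K then a k else b (k - K), ?_, ?_⟩
    · rw [Finset.sum_range_add]
      simp only [add_lt_iff_neg_left, not_lt_zero, if_false, add_tsub_cancel_left, hb]
      rw [Finset.sum_congr rfl fun k hk => by rw [if_pos (Finset.mem_range.1 hk)], ha]
      simp
    · rw [Finset.sum_range_add]
      simp only [add_lt_iff_neg_left, not_lt_zero, if_false, add_tsub_cancel_left, ← hw]
      rw [Finset.sum_congr rfl fun k hk => by rw [if_pos (Finset.mem_range.1 hk)], ← hW]
      refine h.le_of_forall_le _ _ fun l => (map_add_le_add (p l) _ _).trans ?_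
      push_cast
      by_cases hl : m ≤ l
      · have h1 : p l W ≤ η := by
          refine (h.le_left l W).trans ?_
          rw [inv_mul_le_iff₀ (by positivity)]
          refine hm.le.trans ?_
          gcongr
          norm_num
        have h2 := (h.le l w).trans hNw
        nlinarith [mul_nonneg n.cast_nonneg hη.le]
      · have h1 : p l w ≤ η := by
          refine (h.le_right l w).trans ?_
          calc (2 : ℝ) ^ l * q₂ w ≤ 2 ^ m * ((2 ^ m)⁻¹ * η) := by
                gcongr
                · norm_num
                · lia
            _ = η := by field_simp
        linarith [(h.le l W).trans hN]

lemma not_l1Lower_of_isInterpolation {q₁ q₂ N : Seminorm ℝ V} {p : ℕ → Seminorm ℝ V}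
    (h : IsInterpolation q₁ q₂ N p)
    (H : ∀ (R : ℝ) (y : ℕ → V), (∀ k, q₁ (y k) ≤ R) → ∀ c, 0 < c → ¬ L1Lower q₂ y c)
    {y : ℕ → V} {M : ℝ} (hy : ∀ k, N (y k) ≤ M) {c : ℝ} (hc : 0 < c) : ¬ L1Lower N y c := by
  intro hlow
  obtain ⟨n, hn⟩ := exists_nat_gt (M / (c / 2))
  rw [div_lt_iff₀ (by positivity)] at hn
  obtain ⟨K, a, ha, hN⟩ := exists_range_sum_le h H hy (half_pos hc) n
  have := hlow (Finset.range K) a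
  rw [ha] at this
  linarith

end Interpolation

lemma not_containsL1_completion {V : Type*} [SeminormedAddCommGroup V] [NormedSpace ℝ V]
    (h : ∀ (M : ℝ) (y : ℕ → V), (∀ k, ‖y k‖ ≤ M) → ∀ c, 0 < c → ¬ L1Lower norm y c) :
    ¬ ContainsL1 (UniformSpace.Completion V) := by
  intro hX
  obtain ⟨e, R, c, he, hc, hlow⟩ := exists_l1Lower_of_containsL1 hX
  have happrox : ∀ k, ∃ y : V, ‖e k - y‖ < c / 2 := fun k => by
    obtain ⟨y, hy⟩ := (UniformSpace.Completion.denseRange_coe (α := V)).exists_dist_lt (e k)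
      (half_pos hc)
    exact ⟨y, by rwa [← dist_eq_norm]⟩
  choose y hy using happrox
  refine h (R + c / 2) y (fun k => ?_) (c / 2) (half_pos hc) fun s a => ?_
  · rw [← UniformSpace.Completion.norm_coe]
    have := norm_sub_norm_le ((y k : UniformSpace.Completion V)) (e k)
    rw [norm_sub_rev] at this
    linarith [he k, hy k]
  · have h1 := hlow s a
    have h2 := seminorm_sum_smul_le (normSeminorm ℝ (UniformSpace.Completion V))
      (fun k => (hy k).le) s a
    have h3 := norm_add_le (∑ k ∈ s, a k • (y k : UniformSpace.Completion V))
      (∑ k ∈ s, a k • (e k - y k))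
    have e1 : ∑ k ∈ s, a k • (y k : UniformSpace.Completion V) + ∑ k ∈ s, a k • (e k - y k) =
        ∑ k ∈ s, a k • e k := by
      rw [← Finset.sum_add_distrib]
      exact Finset.sum_congr rfl fun k _ => by rw [← smul_add, add_sub_cancel]
    have e2 : ‖∑ k ∈ s, a k • (y k : UniformSpace.Completion V)‖ = ‖∑ k ∈ s, a k • y k‖ := by
      rw [← UniformSpace.Completion.norm_coe (∑ k ∈ s, a k • y k)]
      congr 1
      have h4 := map_sum (UniformSpace.Completion.toComplL (𝕜 := ℝ) (E := V))
        (fun k => a k • y k) s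
      simp only [map_smul] at h4
      exact h4.symm
    rw [e1, e2] at h3
    simp only [coe_normSeminorm] at h2
    linarith

/-- The `ℓ¹`-norm of a finitely supported function, as a seminorm. -/
noncomputable def finsuppL1Seminorm (Γ : Type*) : Seminorm ℝ (Γ →₀ ℝ) :=
  Seminorm.of (fun y => y.sum fun _ a => |a|)
    (fun y z => by
      classical
      rw [Finsupp.sum_of_support_subset _ Finsupp.support_add _ (by simp),
        Finsupp.sum_of_support_subset y Finset.subset_union_left _ (by simp),
        Finsupp.sum_of_support_subset z Finset.subset_union_right _ (by simp),
        ← Finset.sum_add_distrib]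
      exact Finset.sum_le_sum fun γ _ => abs_add_le _ _)
    (fun c y => by
      rw [Finsupp.sum_of_support_subset _ Finsupp.support_smul _ (by simp), Finsupp.sum,
        Finset.mul_sum]
      exact Finset.sum_congr rfl fun γ _ => by simp [abs_mul])

lemma norm_linearCombination_le {Γ E : Type*} [SeminormedAddCommGroup E] [NormedSpace ℝ E]
    {u : Γ → E} (hu : ∀ γ, ‖u γ‖ ≤ 1) (y : Γ →₀ ℝ) :
    ‖Finsupp.linearCombination ℝ u y‖ ≤ finsuppL1Seminorm Γ y := by
  rw [Finsupp.linearCombination_apply]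
  refine (norm_sum_le _ _).trans (Finset.sum_le_sum fun γ _ => ?_)
  rw [norm_smul, Real.norm_eq_abs]
  exact mul_le_of_le_one_right (abs_nonneg _) (hu γ)

/-- A compact space is WRN once `C(L, ℝ)` receives a Banach space without `ℓ¹` whose image
separates points. -/
lemma isWRN_of_continuousLinearMap {L : Type*} [TopologicalSpace L] [CompactSpace L] {X : Type}
    [NormedAddCommGroup X] [NormedSpace ℝ X] [CompleteSpace X] (hX : ¬ ContainsL1 X)
    (J : X →L[ℝ] C(L, ℝ)) (hJ : ∀ s t, s ≠ t → ∃ x, J x s ≠ J x t) : IsWRN L := by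
  let e : L → WeakDual ℝ X := fun t =>
    StrongDual.toWeakDual ((ContinuousMap.evalCLM ℝ t).comp J)
  have he : ∀ t x, e t x = J x t := fun _ _ => rfl
  have hcont : Continuous e := WeakDual.continuous_of_continuous_eval fun x => (J x).continuous
  have hinj : Injective e := fun s t hst => by
    by_contra hne
    obtain ⟨x, hx⟩ := hJ s t hne
    exact hx (by rw [← he, ← he, hst])
  exact ⟨X, _, _, inferInstance, range e, hX, isCompact_range hcont,
    ⟨(hcont.isClosedEmbedding hinj).isEmbedding.toHomeomorph⟩⟩

lemma isWRN_of_not_indepPairs {L : Type} [TopologicalSpace L] [CompactSpace L] [T2Space L]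
    (hsep : ∀ s t : L, s ≠ t → ∃ C, IsClopen C ∧ s ∈ C ∧ t ∉ C) {P : ℕ → Set L → Prop}
    (hP : ∀ C, IsClopen C → ∃ n, P n C)
    (hPind : ∀ n (C : ℕ → Set L), (∀ k, IsClopen (C k)) → (∀ k, P n (C k)) →
      ¬ IndepPairs C fun k => (C k)ᶜ) : IsWRN L := by
  let U := Finsupp.linearCombination ℝ (scaledIndicator P)
  let q : Seminorm ℝ (TaggedClopen P →₀ ℝ) := (normSeminorm ℝ C(L, ℝ)).comp U
  have hq : q ≤ finsuppL1Seminorm (TaggedClopen P) := fun y =>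
    norm_linearCombination_le (fun γ => (norm_scaledIndicator_le P γ).trans (by
      rw [div_le_one (by positivity)]
      simp)) y
  obtain ⟨N, p, hN, hqN, -⟩ := exists_isInterpolation hq
  let _ : SeminormedAddCommGroup (TaggedClopen P →₀ ℝ) :=
    N.toAddGroupSeminorm.toSeminormedAddCommGroup
  let _ : NormedSpace ℝ (TaggedClopen P →₀ ℝ) :=
    { norm_smul_le := fun a b => (map_smul_eq_mul N a b).le }
  have hX : ¬ ContainsL1 (UniformSpace.Completion (TaggedClopen P →₀ ℝ)) :=
    not_containsL1_completion fun M y hy c hc =>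
      not_l1Lower_of_isInterpolation hN
        (fun R z hz d hd => not_l1Lower_linearCombination hPind hz hd) hy hc
  let U' : (TaggedClopen P →₀ ℝ) →L[ℝ] C(L, ℝ) :=
    U.mkContinuous 1 fun y => by
      rw [one_mul]
      exact hqN y
  refine isWRN_of_continuousLinearMap hX
    (U'.extend (UniformSpace.Completion.toComplL (𝕜 := ℝ))) fun s t hst => ?_
  obtain ⟨C, hC, hs, ht⟩ := hsep s t hst
  obtain ⟨n, hn⟩ := hP C hC
  refine ⟨UniformSpace.Completion.toComplL (𝕜 := ℝ) (Finsupp.single ⟨n, C, hC, hn⟩ 1), ?_⟩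
  rw [ContinuousLinearMap.extend_eq _ UniformSpace.Completion.denseRange_coe
    (UniformSpace.Completion.isUniformInducing_coe _)]
  have h1 : U' (Finsupp.single ⟨n, C, hC, hn⟩ 1) = (1 / (n + 1 : ℝ)) • clopenIndicator hC := by
    change U _ = _
    simp [U, scaledIndicator]
  have h2 : (n : ℝ) + 1 ≠ 0 := by positivity
  rw [h1]
  simp [clopenIndicator_apply, hs, ht, h2]

lemma IsWRN.of_homeomorph {K L : Type*} [TopologicalSpace K] [TopologicalSpace L] (h : IsWRN K)
    (e : L ≃ₜ K) : IsWRN L := by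
  obtain ⟨X, i₁, i₂, i₃, S, hX, hS, ⟨g⟩⟩ := h
  exact ⟨X, i₁, i₂, i₃, S, hX, hS, ⟨e.trans g⟩⟩

lemma isWRN_of_continuous_image_of_dual {X : Type} [NormedAddCommGroup X] [NormedSpace ℝ X]
    [CompleteSpace X] {S : Set (WeakDual ℝ X)} [CompactSpace S] (hX : ¬ ContainsL1 X)
    {L : Type} [TopologicalSpace L] [CompactSpace L] [T2Space L]
    (hsep : ∀ s t : L, s ≠ t → ∃ C, IsClopen C ∧ s ∈ C ∧ t ∉ C) {g : S → L} (hg : Continuous g)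
    (hsurj : Surjective g) : IsWRN L := by
  refine isWRN_of_not_indepPairs hsep (P := fun n C => SepBy n (g ⁻¹' C))
    (fun C hC => exists_sepBy (hC.preimage hg)) fun n C hC hPC hind => ?_
  refine not_indepPairs_of_sepBy hX (fun k => (hC k).preimage hg) hPC fun s T => ?_
  obtain ⟨x, hx⟩ := hind s T
  obtain ⟨a, rfl⟩ := hsurj x
  exact ⟨a, hx⟩

/-- A zero-dimensional continuous image of a WRN compact Hausdorff space is WRN. -/
theorem isWRN_of_zeroDimensional_continuous_image
    {K L : Type*} [TopologicalSpace K] [TopologicalSpace L]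
    [CompactSpace K] [T2Space K] [CompactSpace L] [T2Space L]
    (hzd : ∃ B : Set (Set L), (∀ s ∈ B, IsClopen s) ∧ TopologicalSpace.IsTopologicalBasis B)
    (f : K → L) (hf : Continuous f) (hsurj : Function.Surjective f)
    (hK : IsWRN K) : IsWRN L := by
  obtain ⟨X, _, _, _, S, hX, hS, ⟨e⟩⟩ := hK
  have : CompactSpace S := isCompact_iff_compactSpace.1 hS
  let g : C(S, L) := ⟨f ∘ e.symm, hf.comp e.symm.continuous⟩
  have hg : Surjective g := hsurj.comp e.symm.surjective
  let h := (Topology.IsQuotientMap.of_surjective_continuous hg g.continuous).homeomorph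
  have : CompactSpace (Quotient (Setoid.ker g)) := h.symm.compactSpace
  have : T2Space (Quotient (Setoid.ker g)) := h.symm.t2Space
  refine IsWRN.of_homeomorph (isWRN_of_continuous_image_of_dual hX (fun s t hst => ?_)
    (h.symm.continuous.comp g.continuous) (h.symm.surjective.comp hg)) h.symm
  obtain ⟨B, hB, hbasis⟩ := hzd
  obtain ⟨C, hCB, hs, hsub⟩ := hbasis.exists_subset_of_mem_open
    (show h s ∈ ({h t}ᶜ : Set L) from h.injective.ne hst) isOpen_compl_singleton
  exact ⟨h ⁻¹' C, (hB C hCB).preimage h.continuous, hs, fun ht => hsub ht rfl⟩
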